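/- Let M be a positive integer and q ∈ (1, M+1]. Suppose q belongs to the closure of U, q ≠ q', and q is not the right endpoint q_0^* of any connected component of (1, M+1) \ closure(U). Then for every p ∈ (1, q) the Hausdorff dimension of π_{M+1}(U'_q \ U'_p) is strictly positive. -/

import Mathlib

open Set MeasureTheory Filter

noncomputable section

/-- The projection `π_q` of a digit sequence (0-indexed): `∑ d i / q^(i+1)`. -/
def piQ (q : ℝ) (d : ℕ → ℕ) : ℝ := ∑' i : ℕ, (d i : ℝ) / q ^ (i + 1)

/-- `d` is a `q`-expansion of `x` over the alphabet `{0,…,M}`. -/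
def IsExpansion (M : ℕ) (q x : ℝ) (d : ℕ → ℕ) : Prop :=
  (∀ i, d i ≤ M) ∧ piQ q d = x

/-- `U'_q`: digit sequences that are the unique `q`-expansion of their projection. -/
def UnivSeqs (M : ℕ) (q : ℝ) : Set (ℕ → ℕ) :=
  {d | (∀ i, d i ≤ M) ∧ ∀ e : ℕ → ℕ, IsExpansion M q (piQ q d) e → e = d}

/-- The set `U = U(M)` of univoque bases: `q ∈ (1, M+1]` such that `1` has a
unique `q`-expansion over `{0,…,M}`. -/
def UnivBases (M : ℕ) : Set ℝ :=
  {q | 1 < q ∧ q ≤ M + 1 ∧ ∃! d : ℕ → ℕ, IsExpansion M q 1 d}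

/-- The Komornik–Loreti constant `q'(M) = min U(M)`. -/
def KL (M : ℕ) : ℝ := sInf (UnivBases M)

/-- `(a, b)` is a connected component of `(q'(M), M+1) \ closure (U(M))`:
an open subinterval whose endpoints do not lie in that (open) set. -/
def CC (M : ℕ) (a b : ℝ) : Prop :=
  a < b ∧ Ioo a b ⊆ Ioo (KL M) (M + 1) \ closure (UnivBases M) ∧
    a ∉ Ioo (KL M) (M + 1) \ closure (UnivBases M) ∧
    b ∉ Ioo (KL M) (M + 1) \ closure (UnivBases M)

/-- `x ∈ [0, M/(q-1)]` has exactly two distinct `q`-expansions. -/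
def HasExactlyTwoExpansions (M : ℕ) (q x : ℝ) : Prop :=
  ∃ c d : ℕ → ℕ, c ≠ d ∧ IsExpansion M q x c ∧ IsExpansion M q x d ∧
    ∀ e : ℕ → ℕ, IsExpansion M q x e → e = c ∨ e = d

/-- `B_2(M)`: bases `q ∈ (1, M+1]` for which some `x ∈ [0, M/(q-1)]` has exactly
two `q`-expansions. -/
def B2 (M : ℕ) : Set ℝ :=
  {q | 1 < q ∧ q ≤ M + 1 ∧
    ∃ x ∈ Icc (0 : ℝ) (M / (q - 1)), HasExactlyTwoExpansions M q x}

/-- Strict lexicographic order on digit sequences. -/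
def seqLt (a b : ℕ → ℕ) : Prop := ∃ n, (∀ i < n, a i = b i) ∧ a n < b n

/-- Lexicographic order on digit sequences. -/
def seqLe (a b : ℕ → ℕ) : Prop := seqLt a b ∨ a = b

/-- A digit sequence is infinite if it does not end with `0^∞` after a last
nonzero digit (in particular `0^∞` is infinite). -/
def IsInfiniteSeq (a : ℕ → ℕ) : Prop := ¬∃ m, a m ≠ 0 ∧ ∀ i > m, a i = 0

/-- `a = α(q)`, the quasi-greedy `q`-expansion of `1`: the lexicographically
largest infinite `q`-expansion of `1`. -/
def IsQuasiGreedy (M : ℕ) (q : ℝ) (a : ℕ → ℕ) : Prop :=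
  IsExpansion M q 1 a ∧ IsInfiniteSeq a ∧
    ∀ b : ℕ → ℕ, IsExpansion M q 1 b → IsInfiniteSeq b → seqLe b a

/-- `b = β(q)`, the greedy `q`-expansion of `1`: the lexicographically largest
`q`-expansion of `1`. -/
def IsGreedy (M : ℕ) (q : ℝ) (b : ℕ → ℕ) : Prop :=
  IsExpansion M q 1 b ∧ ∀ c : ℕ → ℕ, IsExpansion M q 1 c → seqLe c b

/-- `w⁺`: increase the last digit of a word by one. -/
def plusWord : List ℕ → List ℕ
  | [] => []
  | [a] => [a + 1]
  | a :: b :: rest => a :: plusWord (b :: rest)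

/-- `w⁻`: decrease the last digit of a word by one. -/
def minusWord : List ℕ → List ℕ
  | [] => []
  | [a] => [a - 1]
  | a :: b :: rest => a :: minusWord (b :: rest)

/-- The reflection of a word: `\overline{w} = (M - w_1) ⋯ (M - w_k)`. -/
def reflWord (M : ℕ) (w : List ℕ) : List ℕ := w.map fun a => M - a

/-- The substitution `g(w) = w⁺ \overline{w⁺}`. -/
def gWord (M : ℕ) (w : List ℕ) : List ℕ := plusWord w ++ reflWord M (plusWord w)

/-- The periodic sequence `t^∞` determined by a word `t`. -/
def periodicSeq (t : List ℕ) (i : ℕ) : ℕ := t.getD (i % t.length) 0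

/-- Strict lexicographic order on words. -/
def wordLt (u v : List ℕ) : Prop := List.Lex (· < ·) u v

/-- Lexicographic order on words. -/
def wordLe (u v : List ℕ) : Prop := wordLt u v ∨ u = v

/-- The connected component `(q_0, q_0^*)` of `(q'(M), M+1) \ closure (U(M))` is
generated by the word `t`, and `θ = α(q_0^*)`: `α(q_0) = t^∞` and
`α(q_0^*) = lim_{n→∞} g^n(t)`, i.e. every `g^n(t)` is a prefix of `θ`. -/
def GeneratedBy (M : ℕ) (q₀ q₀star : ℝ) (t : List ℕ) (θ : ℕ → ℕ) : Prop :=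
  CC M q₀ q₀star ∧ t ≠ [] ∧ IsQuasiGreedy M q₀ (periodicSeq t) ∧
    IsQuasiGreedy M q₀star θ ∧
    ∀ n : ℕ, ∀ i < ((gWord M)^[n] t).length, ((gWord M)^[n] t).getD i 0 = θ i


section Projection

variable {M : ℕ} {q : ℝ}

theorem hasSum_const_digits (M : ℕ) (hq : 1 < q) :
    HasSum (fun i : ℕ => (M : ℝ) / q ^ (i + 1)) (M / (q - 1)) := by
  have h0 : 0 < q := by linarith
  have h := (hasSum_geometric_of_lt_one (inv_nonneg.2 h0.le) (inv_lt_one_of_one_lt₀ hq)).mul_left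
    ((M : ℝ) / q)
  have h1 : q - 1 ≠ 0 := by linarith
  have e1 : (fun i : ℕ => (M : ℝ) / q ^ (i + 1)) = fun i => (M : ℝ) / q * q⁻¹ ^ i := by
    ext i
    rw [pow_succ, inv_pow]
    field_simp
  have e2 : (M : ℝ) / (q - 1) = (M : ℝ) / q * (1 - q⁻¹)⁻¹ := by
    rw [show 1 - q⁻¹ = (q - 1) / q by field_simp]
    field_simp
  rw [e1, e2]
  exact h

theorem summable_digits (hq : 1 < q) {d : ℕ → ℕ} (hd : ∀ i, d i ≤ M) :
    Summable (fun i : ℕ => (d i : ℝ) / q ^ (i + 1)) := by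
  have h0 : 0 < q := by linarith
  refine Summable.of_nonneg_of_le (fun i => by positivity) (fun i => ?_)
    (hasSum_const_digits M hq).summable
  have := hd i
  gcongr

theorem piQ_nonneg (hq : 1 < q) (d : ℕ → ℕ) : 0 ≤ piQ q d := by
  have h0 : 0 < q := by linarith
  exact tsum_nonneg fun i => by positivity

theorem piQ_le (hq : 1 < q) {d : ℕ → ℕ} (hd : ∀ i, d i ≤ M) : piQ q d ≤ M / (q - 1) := by
  have h0 : 0 < q := by linarith
  rw [← (hasSum_const_digits M hq).tsum_eq]
  refine (summable_digits hq hd).tsum_le_tsum (fun i => ?_) (hasSum_const_digits M hq).summable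
  have := hd i
  gcongr

theorem piQ_reflect (hq : 1 < q) {d : ℕ → ℕ} (hd : ∀ i, d i ≤ M) :
    piQ q (fun k => M - d k) = M / (q - 1) - piQ q d := by
  rw [← (hasSum_const_digits M hq).tsum_eq, piQ, piQ,
    ← (hasSum_const_digits M hq).summable.tsum_sub (summable_digits hq hd)]
  congr 1
  ext i
  rw [Nat.cast_sub (hd i), sub_div]

theorem piQ_eq_sum_add (hq : 1 < q) {d : ℕ → ℕ} (hd : ∀ i, d i ≤ M) (n : ℕ) :
    piQ q d = ∑ i ∈ Finset.range n, (d i : ℝ) / q ^ (i + 1)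
      + (q ^ n)⁻¹ * piQ q (fun k => d (n + k)) := by
  have h0 : 0 < q := by linarith
  rw [piQ, ← (summable_digits hq hd).sum_add_tsum_nat_add n, piQ, ← tsum_mul_left]
  congr 2
  ext i
  rw [add_comm n i, show i + n + 1 = n + (i + 1) by ring, pow_add q n]
  field_simp

theorem piQ_sub_of_agree (hq : 1 < q) {s t : ℕ → ℕ} (hs : ∀ i, s i ≤ M) (ht : ∀ i, t i ≤ M)
    {n : ℕ} (h : ∀ i < n, s i = t i) :
    piQ q s - piQ q t
      = (q ^ n)⁻¹ * (piQ q (fun k => s (n + k)) - piQ q (fun k => t (n + k))) := by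
  rw [piQ_eq_sum_add hq hs n, piQ_eq_sum_add hq ht n,
    Finset.sum_congr rfl fun i hi => by rw [h i (Finset.mem_range.1 hi)]]
  ring

theorem piQ_eq_head_add (hq : 1 < q) {d : ℕ → ℕ} (hd : ∀ i, d i ≤ M) :
    q * piQ q d = d 0 + piQ q (fun k => d (k + 1)) := by
  have h0 : q ≠ 0 := by linarith
  rw [piQ_eq_sum_add hq hd 1]
  simp only [Finset.sum_range_one, zero_add, pow_one, add_comm 1]
  field_simp

theorem piQ_sub_of_first_diff (hq : 1 < q) {s t : ℕ → ℕ} (hs : ∀ i, s i ≤ M)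
    (ht : ∀ i, t i ≤ M) {k : ℕ} (h : ∀ i < k, s i = t i) :
    piQ q s - piQ q t = (q ^ (k + 1))⁻¹ * (((s k : ℝ) - t k)
      + (piQ q (fun j => s (k + 1 + j)) - piQ q (fun j => t (k + 1 + j)))) := by
  have h0 : q ≠ 0 := by linarith
  have e1 := piQ_eq_head_add hq (d := fun j => s (k + j)) fun i => hs _
  have e2 := piQ_eq_head_add hq (d := fun j => t (k + j)) fun i => ht _
  simp only [add_zero] at e1 e2
  rw [piQ_sub_of_agree hq hs ht h, pow_succ, mul_inv, mul_assoc]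
  congr 1
  simp only [add_assoc, add_comm 1]
  rw [eq_inv_mul_iff_mul_eq₀ h0, mul_sub, e1, e2]
  ring

theorem abs_piQ_sub_le_of_agree (hq : 1 < q) {s t : ℕ → ℕ} (hs : ∀ i, s i ≤ M)
    (ht : ∀ i, t i ≤ M) {n : ℕ} (h : ∀ i < n, s i = t i) :
    |piQ q s - piQ q t| ≤ (q ^ n)⁻¹ * (M / (q - 1)) := by
  have h0 : 0 < q := by linarith
  rw [piQ_sub_of_agree hq hs ht h, abs_mul, abs_of_pos (by positivity : 0 < (q ^ n)⁻¹)]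
  gcongr
  rw [abs_le]
  have a1 := piQ_nonneg hq fun k => s (n + k)
  have a2 := piQ_nonneg hq fun k => t (n + k)
  have a3 := piQ_le hq (d := fun k => s (n + k)) fun i => hs _
  have a4 := piQ_le hq (d := fun k => t (n + k)) fun i => ht _
  constructor <;> linarith

theorem piQ_anti {q' : ℝ} (hq : 1 < q) (hqq : q ≤ q') {d : ℕ → ℕ} (hd : ∀ i, d i ≤ M) :
    piQ q' d ≤ piQ q d := by
  have h0 : 0 < q := by linarith
  refine (summable_digits (by linarith) hd).tsum_le_tsum (fun i => ?_) (summable_digits hq hd)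
  gcongr

theorem piQ_strictAnti {q' : ℝ} (hq : 1 < q) (hqq : q < q') {d : ℕ → ℕ} (hd : ∀ i, d i ≤ M)
    (h : d 0 ≠ 0) : piQ q' d < piQ q d := by
  have h0 : 0 < q := by linarith
  have h1 : (0 : ℝ) < d 0 := by exact_mod_cast Nat.pos_of_ne_zero h
  refine Summable.tsum_lt_tsum (i := 0) (fun i => ?_) ?_ (summable_digits (by linarith) hd)
    (summable_digits hq hd)
  · dsimp only
    gcongr
  · gcongr

/-- Remainders of the greedy algorithm in base `q`. -/
def greedyRem (M : ℕ) (q x : ℝ) : ℕ → ℝ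
  | 0 => x
  | n + 1 => q * greedyRem M q x n - (min M ⌊q * greedyRem M q x n⌋₊ : ℕ)

/-- Digits of the greedy algorithm in base `q`. -/
def greedyDigit (M : ℕ) (q x : ℝ) (n : ℕ) : ℕ := min M ⌊q * greedyRem M q x n⌋₊

theorem greedyRem_mem (hq : 1 < q) (hqM : q ≤ M + 1) {x : ℝ} (hx : x ∈ Icc 0 (M / (q - 1))) :
    ∀ n, greedyRem M q x n ∈ Icc 0 (M / (q - 1))
  | 0 => hx
  | n + 1 => by
    have ih := greedyRem_mem hq hqM hx n
    have h1 : 0 < q - 1 := by linarith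
    rw [greedyRem]
    set r := greedyRem M q x n
    have hr0 : 0 ≤ q * r := mul_nonneg (by linarith) ih.1
    have hf := Nat.floor_le hr0
    have hf' := Nat.lt_floor_add_one (q * r)
    rcases le_total M ⌊q * r⌋₊ with h | h
    · rw [min_eq_left h]
      have h' : (M : ℝ) ≤ ⌊q * r⌋₊ := by exact_mod_cast h
      refine ⟨by linarith, ?_⟩
      have e : (M : ℝ) / (q - 1) = q * (M / (q - 1)) - M := by field_simp; ring
      rw [e]
      have := ih.2
      gcongr
    · rw [min_eq_right h]
      refine ⟨by linarith, ?_⟩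
      have : 1 ≤ M / (q - 1) := by rw [one_le_div h1]; linarith
      linarith

theorem exists_isExpansion (hq : 1 < q) (hqM : q ≤ M + 1) {x : ℝ}
    (hx : x ∈ Icc 0 (M / (q - 1))) : ∃ d, IsExpansion M q x d := by
  have h0 : 0 < q := by linarith
  have hd : ∀ i, greedyDigit M q x i ≤ M := fun i => min_le_left _ _
  refine ⟨greedyDigit M q x, hd, ?_⟩
  have key : ∀ n, piQ q (greedyDigit M q x) - x
      = (q ^ n)⁻¹ * (piQ q (fun k => greedyDigit M q x (n + k)) - greedyRem M q x n) := by
    intro n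
    induction n with
    | zero => simp [greedyRem]
    | succ n ih =>
      have e1 := piQ_eq_head_add hq (d := fun j => greedyDigit M q x (n + j)) fun i => hd _
      have e2 : greedyRem M q x (n + 1) = q * greedyRem M q x n - greedyDigit M q x n := rfl
      rw [ih, e2, pow_succ, mul_inv, mul_assoc]
      congr 1
      simp only [add_zero] at e1
      simp only [add_assoc, add_comm 1]
      rw [eq_inv_mul_iff_mul_eq₀ h0.ne', mul_sub, e1]
      ring
  have hb : ∀ n, |piQ q (greedyDigit M q x) - x| ≤ (q⁻¹) ^ n * (M / (q - 1)) := by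
    intro n
    rw [key n, abs_mul, abs_of_pos (by positivity : 0 < (q ^ n)⁻¹), inv_pow]
    gcongr
    have a1 := greedyRem_mem hq hqM hx n
    have a2 := piQ_nonneg hq fun k => greedyDigit M q x (n + k)
    have a3 := piQ_le hq (d := fun k => greedyDigit M q x (n + k)) fun i => hd _
    rw [abs_le]
    constructor <;> linarith [a1.1, a1.2]
  have hlim := (tendsto_pow_atTop_nhds_zero_of_lt_one (inv_nonneg.2 h0.le)
    (inv_lt_one_of_one_lt₀ hq)).mul_const ((M : ℝ) / (q - 1))
  rw [zero_mul] at hlim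
  have := ge_of_tendsto' hlim hb
  exact sub_eq_zero.1 (abs_nonpos_iff.1 this)

end Projection

section Unique

variable {M : ℕ} {q : ℝ}

theorem UnivSeqs.tail_lt_one (hq : 1 < q) (hqM : q ≤ M + 1) {d : ℕ → ℕ} (hd : d ∈ UnivSeqs M q)
    {n : ℕ} (hn : d n < M) : piQ q (fun k => d (n + 1 + k)) < 1 := by
  by_contra! hc
  have hle := piQ_le hq (d := fun k => d (n + 1 + k)) fun i => hd.1 _
  obtain ⟨f, hf, hfe⟩ := exists_isExpansion hq hqM
    (x := piQ q (fun k => d (n + 1 + k)) - 1) ⟨by linarith, by linarith⟩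
  let e : ℕ → ℕ := fun k => if k < n then d k else if k = n then d n + 1 else f (k - (n + 1))
  have he : ∀ i, e i ≤ M := by
    intro i
    simp only [e]
    split_ifs
    exacts [hd.1 i, hn, hf _]
  have hagree : ∀ i < n, e i = d i := fun i hi => by simp [e, hi]
  have hen : e n = d n + 1 := by simp [e]
  have htail : (fun j => e (n + 1 + j)) = f := by
    ext j
    simp only [e]
    rw [if_neg (by omega), if_neg (by omega)]
    congr 1
    omega
  have hpi := piQ_sub_of_first_diff hq he hd.1 hagree
  rw [htail, hfe, hen] at hpi
  have : piQ q e = piQ q d := by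
    have : piQ q e - piQ q d = 0 := by rw [hpi]; push_cast; ring
    linarith
  have := hd.2 e ⟨he, this⟩
  rw [this] at hen
  omega

theorem UnivSeqs.reflect (hq : 1 < q) {d : ℕ → ℕ} (hd : d ∈ UnivSeqs M q) :
    (fun k => M - d k) ∈ UnivSeqs M q := by
  refine ⟨fun i => Nat.sub_le _ _, fun e ⟨he, hpe⟩ => ?_⟩
  rw [piQ_reflect hq hd.1] at hpe
  have h := hd.2 (fun k => M - e k) ⟨fun i => Nat.sub_le _ _, by
    rw [piQ_reflect hq he, hpe]; ring⟩
  ext k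
  have h1 := congrFun h k
  have h2 := he k
  omega

theorem mem_UnivSeqs_of_tail_lt_one (hq : 1 < q) {d : ℕ → ℕ} (hd : ∀ i, d i ≤ M)
    (h1 : ∀ n, piQ q (fun k => d (n + k)) < 1)
    (h2 : ∀ n, piQ q (fun k => M - d (n + k)) < 1) : d ∈ UnivSeqs M q := by
  have h0 : 0 < q := by linarith
  refine ⟨hd, fun e ⟨he, hpe⟩ => ?_⟩
  by_contra hne
  have hex : ∃ n, e n ≠ d n := by
    by_contra! h
    exact hne (funext h)
  classical
  have hmin : ∀ i < Nat.find hex, e i = d i := fun i hi => not_not.1 (Nat.find_min hex hi)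
  have hn := Nat.find_spec hex
  set n := Nat.find hex
  have hpi := piQ_sub_of_first_diff hq he hd hmin
  rw [hpe, sub_self, eq_comm, mul_eq_zero, or_iff_right (by positivity)] at hpi
  have t1 := h1 (n + 1)
  have t2 := h2 (n + 1)
  rw [piQ_reflect hq fun k => hd _] at t2
  have t3 := piQ_nonneg hq fun j => e (n + 1 + j)
  have t4 := piQ_le hq (d := fun j => e (n + 1 + j)) fun i => he _
  rcases lt_or_gt_of_ne hn with h | h
  · have : (e n : ℝ) + 1 ≤ d n := by exact_mod_cast h
    linarith
  · have : (d n : ℝ) + 1 ≤ e n := by exact_mod_cast h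
    linarith

end Unique

/-- `a` satisfies the lexicographic conditions characterizing univoque expansions of `1`:
each shift is at most `a`, and the reflection of each proper shift is strictly smaller. -/
structure IsUnivoqueSeq (M : ℕ) (a : ℕ → ℕ) : Prop where
  le_max : ∀ i, a i ≤ M
  zero_ne : a 0 ≠ 0
  shift_le : ∀ i k, (∀ j < k, a (i + j) = a j) → a (i + k) ≤ a k
  reflect_le : ∀ i k, 0 < i → (∀ j < k, M - a (i + j) = a j) → M - a (i + k) ≤ a k
  reflect_ne : ∀ i, 0 < i → ∃ k, M - a (i + k) ≠ a k

section Univoque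

variable {M : ℕ} {u : ℝ} {a : ℕ → ℕ}

theorem le_of_piQ_le_one (hu : 1 < u) (huM : u ≤ M + 1) (ha : a ∈ UnivSeqs M u)
    (ha1 : piQ u a = 1) {s : ℕ → ℕ} (hs : ∀ i, s i ≤ M) (hs1 : piQ u s ≤ 1) {k : ℕ}
    (h : ∀ j < k, s j = a j) : s k ≤ a k := by
  by_contra! hc
  have h0 : 0 < u := by linarith
  have hpi := piQ_sub_of_first_diff hu hs ha.1 h
  have t1 := UnivSeqs.tail_lt_one hu huM ha (lt_of_lt_of_le hc (hs k))
  have t2 := piQ_nonneg hu fun j => s (k + 1 + j)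
  have t3 : (a k : ℝ) + 1 ≤ s k := by exact_mod_cast hc
  have : 0 < piQ u s - piQ u a := by
    rw [hpi]
    exact mul_pos (by positivity) (by linarith)
  linarith

theorem zero_ne_of_univoque (hu : 1 < u) (huM : u ≤ M + 1) (hM : 0 < M)
    (ha : a ∈ UnivSeqs M u) (ha1 : piQ u a = 1) : a 0 ≠ 0 := by
  intro h
  have t := UnivSeqs.tail_lt_one hu huM ha (n := 0) (by omega)
  have e := piQ_eq_head_add hu ha.1
  simp only [zero_add, add_comm 1] at t
  rw [h, ha1] at e
  push_cast at e
  linarith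

theorem piQ_shift_le_one (hu : 1 < u) (huM : u ≤ M + 1) (ha : a ∈ UnivSeqs M u)
    (ha1 : piQ u a = 1) : ∀ i, piQ u (fun k => a (i + k)) ≤ 1
  | 0 => by simp [ha1]
  | i + 1 => by
    rcases lt_or_eq_of_le (ha.1 i) with h | h
    · exact (UnivSeqs.tail_lt_one hu huM ha h).le
    · have ih := piQ_shift_le_one hu huM ha ha1 i
      have e := piQ_eq_head_add hu (d := fun k => a (i + k)) fun _ => ha.1 _
      simp only [add_zero, h] at e
      simp only [add_assoc, add_comm 1]
      nlinarith

theorem piQ_reflect_shift_lt_one (hu : 1 < u) (huM : u ≤ M + 1) (hM : 0 < M)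
    (ha : a ∈ UnivSeqs M u) (ha1 : piQ u a = 1) :
    ∀ i, piQ u (fun k => M - a (i + 1 + k)) < 1
  | 0 => by
    have h := zero_ne_of_univoque hu huM hM ha ha1
    exact UnivSeqs.tail_lt_one hu huM (UnivSeqs.reflect hu ha) (n := 0) (by omega)
  | i + 1 => by
    by_cases h : a (i + 1) = 0
    · have ih := piQ_reflect_shift_lt_one hu huM hM ha ha1 i
      have e := piQ_eq_head_add hu (d := fun k => M - a (i + 1 + k)) fun _ => Nat.sub_le _ _
      simp only [add_zero, h, Nat.sub_zero] at e
      have e2 : (fun k => M - a (i + 1 + 1 + k)) = fun k => M - a (i + 1 + (k + 1)) := by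
        ext k
        congr 2
        omega
      rw [e2]
      nlinarith
    · exact UnivSeqs.tail_lt_one hu huM (UnivSeqs.reflect hu ha) (n := i + 1)
        (by have := ha.1 (i + 1); omega)

theorem isUnivoqueSeq_of_mem (hu : 1 < u) (huM : u ≤ M + 1) (hM : 0 < M)
    (ha : a ∈ UnivSeqs M u) (ha1 : piQ u a = 1) : IsUnivoqueSeq M a where
  le_max := ha.1
  zero_ne := zero_ne_of_univoque hu huM hM ha ha1
  shift_le i k h := le_of_piQ_le_one hu huM ha ha1 (s := fun j => a (i + j)) (fun _ => ha.1 _)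
    (piQ_shift_le_one hu huM ha ha1 i) h
  reflect_le i k hi h := by
    obtain ⟨i, rfl⟩ := Nat.exists_eq_add_of_lt hi
    rw [zero_add] at h ⊢
    exact le_of_piQ_le_one hu huM ha ha1 (s := fun j => M - a (i + 1 + j))
      (fun _ => Nat.sub_le _ _) (piQ_reflect_shift_lt_one hu huM hM ha ha1 i).le h
  reflect_ne i hi := by
    obtain ⟨i, rfl⟩ := Nat.exists_eq_add_of_lt hi
    rw [zero_add]
    by_contra! h
    have := piQ_reflect_shift_lt_one hu huM hM ha ha1 i
    rw [show (fun k => M - a (i + 1 + k)) = a from funext h] at this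
    linarith

end Univoque

/-- No proper suffix of the prefix of `a` of length `m` is the reflection of a prefix of `a`. -/
def IsGoodLength (M : ℕ) (a : ℕ → ℕ) (m : ℕ) : Prop :=
  ∀ i, 0 < i → i < m → ∃ k, i + k < m ∧ M - a (i + k) ≠ a k

theorem IsUnivoqueSeq.exists_isGoodLength {M : ℕ} {a : ℕ → ℕ} (ha : IsUnivoqueSeq M a) (N : ℕ) :
    ∃ m ≥ N, IsGoodLength M a m := by
  classical
  choose! κ hκ using ha.reflect_ne
  let m := N + ∑ i ∈ Finset.range N, (i + κ i + 1)
  by_cases hm : IsGoodLength M a m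
  · exact ⟨m, Nat.le_add_right _ _, hm⟩
  have hex : ∃ i, 0 < i ∧ i < m ∧ ∀ k, i + k < m → M - a (i + k) = a k := by
    simp only [IsGoodLength] at hm
    push Not at hm
    exact hm
  obtain ⟨hi0, him, hi⟩ := Nat.find_spec hex
  have hmin := fun j (hj : j < Nat.find hex) => Nat.find_min hex hj
  set i := Nat.find hex
  refine ⟨i, ?_, fun j hj0 hji => ?_⟩
  · by_contra! hlt
    have h1 := Finset.single_le_sum (f := fun i => i + κ i + 1) (fun _ _ => Nat.zero_le _)
      (Finset.mem_range.2 hlt)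
    exact hκ i hi0 (hi (κ i) (by simp only [m]; omega))
  · by_contra! hall
    have hj := hmin j hji
    push Not at hj
    have hexk := hj hj0 (hji.trans him)
    obtain ⟨hkm, hk⟩ := Nat.find_spec hexk
    have hkmin := fun l (hl : l < Nat.find hexk) => Nat.find_min hexk hl
    set k := Nat.find hexk
    clear_value k
    have hagree : ∀ l < k, M - a (j + l) = a l := by
      intro l hl
      have := hkmin l hl
      push Not at this
      exact this (by omega)
    have hlt : M - a (j + k) < a k := lt_of_le_of_ne (ha.reflect_le j k hj0 hagree) hk
    have hik : i ≤ j + k := by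
      by_contra! h
      exact hk (hall k h)
    obtain ⟨l, rfl⟩ : ∃ l, k = i - j + l := ⟨k - (i - j), by omega⟩
    have hsh := ha.shift_le (i - j) l fun l' hl' => by
      have e1 := hagree (i - j + l') (by omega)
      have e2 := hi l' (by omega)
      rw [show j + (i - j + l') = i + l' by omega] at e1
      omega
    have e2 := hi l (by omega)
    rw [show j + (i - j + l) = i + l by omega] at hlt
    omega

/-- The prefix of `s` of length `m` is lexicographically at most that of `a`. -/
def LexLeUpto (a : ℕ → ℕ) (m : ℕ) (s : ℕ → ℕ) : Prop :=
  ∀ k < m, (∀ j < k, s j = a j) → s k ≤ a k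

theorem piQ_le_of_lexLeUpto {M m : ℕ} {q δ : ℝ} {a s : ℕ → ℕ} (hq : 1 < q) (hδ : 0 < δ)
    (ha : ∀ i, a i ≤ M) (haδ : piQ q a + (q ^ m)⁻¹ * (M / (q - 1)) ≤ 1 - δ)
    (hs : ∀ i, s i ≤ M) (hlex : ∀ n, LexLeUpto a m (fun k => s (n + k))) :
    piQ q s ≤ 1 - δ := by
  have h0 : 0 < q := by linarith
  have h1 : 0 < q - 1 := by linarith
  have haδ' : piQ q a ≤ 1 - δ := by
    have : 0 ≤ (q ^ m)⁻¹ * (M / (q - 1)) := by positivity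
    linarith
  have hbdd : BddAbove (range fun n => piQ q (fun k => s (n + k))) :=
    ⟨M / (q - 1), by rintro _ ⟨n, rfl⟩; exact piQ_le hq fun _ => hs _⟩
  set S := ⨆ n, piQ q (fun k => s (n + k)) with hS
  have claim : ∀ n, piQ q (fun k => s (n + k)) ≤ 1 - δ ∨
      ∃ k : ℕ, piQ q (fun k => s (n + k)) ≤ 1 - δ + (q ^ (k + 1))⁻¹ * (S - 1) := by
    intro n
    by_cases hag : ∀ k < m, s (n + k) = a k
    · left
      have := abs_piQ_sub_le_of_agree hq (s := fun k => s (n + k)) (fun _ => hs _) ha hag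
      have := (abs_le.1 this).2
      linarith
    · right
      push Not at hag
      classical
      obtain ⟨hkm, hk⟩ := Nat.find_spec hag
      have hmin : ∀ j < Nat.find hag, s (n + j) = a j := by
        intro j hj
        have := Nat.find_min hag hj
        push Not at this
        exact this (by omega)
      set k := Nat.find hag
      have hlt : s (n + k) < a k := lt_of_le_of_ne (hlex n k hkm hmin) hk
      have hpi := piQ_sub_of_first_diff hq (s := fun k => s (n + k)) (fun _ => hs _) ha hmin
      have t1 : (s (n + k) : ℝ) + 1 ≤ a k := by exact_mod_cast hlt
      have t2 := piQ_nonneg hq fun j => a (k + 1 + j)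
      have t3 := le_ciSup hbdd (n + (k + 1))
      simp only [add_assoc] at t3 hpi t2
      refine ⟨k, ?_⟩
      have : (q ^ (k + 1))⁻¹ * (((s (n + k) : ℝ) - a k)
          + (piQ q (fun j => s (n + (k + (1 + j)))) - piQ q (fun j => a (k + (1 + j)))))
          ≤ (q ^ (k + 1))⁻¹ * (S - 1) := by
        gcongr
        linarith
      linarith
  have hS1 : S ≤ 1 := by
    by_contra! hc
    have : S ≤ S - δ := ciSup_le fun n => by
      rcases claim n with h | ⟨k, h⟩
      · linarith
      · have : (q ^ (k + 1))⁻¹ ≤ 1 := inv_le_one_of_one_le₀ (one_le_pow₀ hq.le)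
        nlinarith
    linarith
  have h := claim 0
  simp only [zero_add] at h
  rcases h with h | ⟨k, h⟩
  · exact h
  · have : 0 ≤ (q ^ (k + 1))⁻¹ := by positivity
    nlinarith

/-- The digit `a i`, lowered by one at the last position `m - 1` when `c` is `false`. -/
def lowerLast (a : ℕ → ℕ) (m : ℕ) (c : Bool) (i : ℕ) : ℕ :=
  if c = false ∧ i + 1 = m then a i - 1 else a i

/-- The sign of the `j`-th block: it flips after every block with `x j = true`. -/
def blockSign (x : ℕ → Bool) : ℕ → Bool
  | 0 => false
  | j + 1 => xor (blockSign x j) (x j)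

/-- The concatenation of the words `t⁺` (where `x j = true`) and `t` (where `x j = false`),
reflected according to `blockSign x`, where `t⁺ = a 0 ⋯ a (m - 1)`. -/
def blockSeq (M : ℕ) (a : ℕ → ℕ) (m : ℕ) (x : ℕ → Bool) (n : ℕ) : ℕ :=
  if blockSign x (n / m) then M - lowerLast a m (x (n / m)) (n % m)
  else lowerLast a m (x (n / m)) (n % m)

section Blocks

variable {M m : ℕ} {a : ℕ → ℕ}

theorem lowerLast_le (a : ℕ → ℕ) (m : ℕ) (c : Bool) (i : ℕ) : lowerLast a m c i ≤ a i := by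
  unfold lowerLast
  split_ifs <;> omega

theorem lowerLast_of_ne (c : Bool) {i : ℕ} (h : i + 1 ≠ m) : lowerLast a m c i = a i := by
  simp [lowerLast, h]

theorem IsUnivoqueSeq.last_pos (ha : IsUnivoqueSeq M a) (hg : IsGoodLength M a m) (hm : 2 ≤ m) :
    0 < a (m - 1) ∧ M < 2 * a 0 := by
  obtain ⟨k, hk, hne⟩ := hg (m - 1) (by omega) (by omega)
  obtain rfl : k = 0 := by omega
  have h1 := ha.reflect_le (m - 1) 0 (by omega) (by simp)
  have h2 := ha.shift_le (m - 1) 0 (by simp)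
  have h3 := ha.le_max 0
  simp only [add_zero] at *
  omega

theorem IsUnivoqueSeq.lexLeUpto_window (ha : IsUnivoqueSeq M a) (hg : IsGoodLength M a m)
    (hm : 2 ≤ m) {i : ℕ} (hi : i < m) (c : Bool) {t : ℕ → ℕ}
    (ht1 : ∀ k, i + k < m → t k = lowerLast a m c (i + k))
    (ht2 : ∀ k, m ≤ i + k → k < m → t k = if c then M - a (i + k - m) else a (i + k - m)) :
    LexLeUpto a m t ∧ LexLeUpto a m (fun k => M - t k) := by
  obtain ⟨hlast, hzero⟩ := ha.last_pos hg hm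
  have ht3 : ∀ k, i + k + 1 < m → t k = a (i + k) := fun k hk => by
    rw [ht1 k (by omega), lowerLast_of_ne _ (by omega)]
  have htl : t (m - 1 - i) = if c then a (m - 1) else a (m - 1) - 1 := by
    rw [ht1 _ (by omega), show i + (m - 1 - i) = m - 1 by omega, lowerLast]
    cases c <;> simp
    omega
  have hrefl : ∀ l, 0 < i → (∀ j < l, M - a j = a (m - i + j)) → M - a l ≤ a (m - i + l) := by
    intro l hi0 h
    have := ha.reflect_le (m - i) l (by omega) fun j hj => by
      have := h j hj
      have := ha.le_max j
      omega
    have := ha.le_max l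
    omega
  refine ⟨fun k hk hag => ?_, fun k hk hag => ?_⟩
  · rcases lt_or_ge (i + k) m with hik | hik
    · rw [ht1 k hik]
      refine (lowerLast_le _ _ _ _).trans (ha.shift_le i k fun j hj => ?_)
      rw [← hag j hj, ht3 j (by omega)]
    · obtain ⟨l, rfl⟩ : ∃ l, k = m - i + l := ⟨k - (m - i), by omega⟩
      cases c with
      | false =>
        have h1 := hag (m - 1 - i) (by omega)
        have h2 := ha.shift_le i (m - 1 - i) fun j hj => by
          rw [← hag j (by omega), ht3 j (by omega)]
        rw [show i + (m - 1 - i) = m - 1 by omega] at h2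
        simp only [htl, Bool.false_eq_true, if_false] at h1
        omega
      | true =>
        have ht4 : ∀ j ≤ l, t (m - i + j) = M - a j := fun j hj => by
          rw [ht2 _ (by omega) (by omega), show i + (m - i + j) - m = j by omega]
          simp
        rw [ht4 l le_rfl]
        exact hrefl l (by omega) fun j hj => by rw [← ht4 j hj.le, hag _ (by omega)]
  · simp only at hag ⊢
    rcases Nat.eq_zero_or_pos i with rfl | hi0
    · have h0 := ht3 0 (by omega)
      rcases Nat.eq_zero_or_pos k with rfl | hk0
      · simp only [add_zero] at h0
        omega
      · have := hag 0 hk0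
        simp only [add_zero] at h0
        omega
    · obtain ⟨k', hk', hne⟩ := hg i hi0 hi
      rcases lt_or_ge (i + k) m with hik | hik
      · have hag' : ∀ j < k, M - a (i + j) = a j := fun j hj => by
          rw [← hag j hj, ht3 j (by omega)]
        have h1 := ha.reflect_le i k hi0 hag'
        rcases eq_or_ne (i + k + 1) m with hl | hl
        · have h2 : k' = k := by
            by_contra hkk
            exact hne (hag' k' (by omega))
          subst h2
          rw [ht1 _ hik, lowerLast]
          split_ifs <;> omega
        · rw [ht3 k (by omega)]
          exact h1
      · obtain ⟨l, rfl⟩ : ∃ l, k = m - i + l := ⟨k - (m - i), by omega⟩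
        cases c with
        | true =>
          exfalso
          apply hne
          rw [← hag k' (by omega), ht1 k' hk', lowerLast]
          simp
        | false =>
          have ht4 : ∀ j ≤ l, t (m - i + j) = a j := fun j hj => by
            rw [ht2 _ (by omega) (by omega), show i + (m - i + j) - m = j by omega]
            simp
          rw [ht4 l le_rfl]
          exact hrefl l hi0 fun j hj => by rw [← ht4 j hj.le, hag _ (by omega)]

theorem blockSeq_le (ha : ∀ i, a i ≤ M) (x : ℕ → Bool) (n : ℕ) : blockSeq M a m x n ≤ M := by
  have h1 := lowerLast_le a m (x (n / m)) (n % m)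
  have h2 := ha (n % m)
  unfold blockSeq
  split_ifs <;> omega

theorem blockSeq_mul_add (x : ℕ → Bool) (j : ℕ) {i : ℕ} (hi : i < m) :
    blockSeq M a m x (m * j + i) =
      if blockSign x j then M - lowerLast a m (x j) i else lowerLast a m (x j) i := by
  rw [blockSeq, Nat.mul_add_div (by omega), Nat.div_eq_of_lt hi, Nat.mul_add_mod,
    Nat.mod_eq_of_lt hi, add_zero]

theorem IsUnivoqueSeq.lexLeUpto_blockSeq (ha : IsUnivoqueSeq M a) (hg : IsGoodLength M a m)
    (hm : 2 ≤ m) (x : ℕ → Bool) (n : ℕ) :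
    LexLeUpto a m (fun k => blockSeq M a m x (n + k)) ∧
      LexLeUpto a m (fun k => M - blockSeq M a m x (n + k)) := by
  obtain ⟨j, i, hi, rfl⟩ : ∃ j i, i < m ∧ n = m * j + i :=
    ⟨n / m, n % m, Nat.mod_lt _ (by omega), (Nat.div_add_mod n m).symm⟩
  have hb1 : ∀ k, i + k < m → blockSeq M a m x (m * j + i + k) =
      if blockSign x j then M - lowerLast a m (x j) (i + k) else lowerLast a m (x j) (i + k) :=
    fun k hk => by rw [add_assoc, blockSeq_mul_add x j hk]
  have hb2 : ∀ k, m ≤ i + k → k < m → blockSeq M a m x (m * j + i + k) =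
      if xor (blockSign x j) (x j) then M - a (i + k - m) else a (i + k - m) := by
    intro k hk hkm
    rw [show m * j + i + k = m * (j + 1) + (i + k - m) by rw [mul_add]; omega,
      blockSeq_mul_add x (j + 1) (by omega), lowerLast_of_ne _ (by omega), blockSign]
  have hle := blockSeq_le (m := m) ha.le_max x
  cases hsgn : blockSign x j
  · exact ha.lexLeUpto_window hg hm hi (x j)
      (fun k hk => by simp [hb1 k hk, hsgn]) (fun k hk hkm => by simp [hb2 k hk hkm, hsgn])
  · have h := ha.lexLeUpto_window hg hm hi (x j) (t := fun k => M - blockSeq M a m x (m * j + i + k))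
      (fun k hk => by
        have h1 := lowerLast_le a m (x j) (i + k)
        have h2 := ha.le_max (i + k)
        simp only [hb1 k hk, hsgn, if_true]
        omega)
      (fun k hk hkm => by
        have h2 := ha.le_max (i + k - m)
        simp only [hb2 k hk hkm, hsgn]
        cases x j
        · simp
          omega
        · simp)
    refine ⟨?_, h.1⟩
    convert h.2 using 3 with k
    have := hle (m * j + i + k)
    omega

theorem blockSign_congr {x y : ℕ → Bool} {n : ℕ} (h : ∀ j < n, x j = y j) :
    ∀ j ≤ n, blockSign x j = blockSign y j
  | 0, _ => rfl
  | j + 1, hj => by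
    rw [blockSign, blockSign, blockSign_congr h j (by omega), h j (by omega)]

theorem blockSeq_congr {x y : ℕ → Bool} {n : ℕ} (h : ∀ j < n, x j = y j) {i : ℕ}
    (hi : i < m * n + (m - 1)) : blockSeq M a m x i = blockSeq M a m y i := by
  have hm : 0 < m := by
    rcases Nat.eq_zero_or_pos m with rfl | h
    · simp at hi
    · exact h
  have hd := Nat.div_add_mod i m
  have hr := Nat.mod_lt i hm
  have hle : i / m ≤ n := by
    by_contra! hc
    have := Nat.mul_le_mul_left m (Nat.succ_le_of_lt hc)
    rw [Nat.mul_succ] at this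
    omega
  rw [blockSeq, blockSeq, blockSign_congr h _ hle]
  rcases hle.lt_or_eq with hlt | heq
  · rw [h _ hlt]
  · rw [heq] at hd
    rw [lowerLast_of_ne _ (by omega), lowerLast_of_ne _ (by omega)]

theorem blockSeq_ne {x y : ℕ → Bool} {n : ℕ} (ha : a (m - 1) ≤ M) (ha0 : 0 < a (m - 1))
    (hm : 0 < m) (h : ∀ j < n, x j = y j) (hn : x n ≠ y n) :
    blockSeq M a m x (m * n + (m - 1)) ≠ blockSeq M a m y (m * n + (m - 1)) := by
  rw [blockSeq_mul_add x n (by omega), blockSeq_mul_add y n (by omega),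
    blockSign_congr h n le_rfl]
  have : m - 1 + 1 = m := by omega
  cases hx : x n <;> cases hy : y n <;> simp_all [lowerLast] <;> split_ifs <;> omega

end Blocks

theorem range_piQ_two_supset :
    Icc (0 : ℝ) 1 ⊆ range fun z : ℕ → Bool => piQ 2 (fun j => (z j).toNat) := by
  intro x hx
  obtain ⟨d, hd, hdx⟩ := exists_isExpansion (M := 1) (q := 2) (x := x) (by norm_num) (by norm_num)
    (by norm_num; exact hx)
  refine ⟨fun j => decide (d j = 1), ?_⟩
  rw [← hdx]
  refine congrArg (piQ 2) (funext fun j => ?_)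
  have := hd j
  interval_cases h : d j <;> simp [h]

theorem exists_first_ne {z z' : ℕ → Bool} (h : z ≠ z') :
    ∃ n, (∀ j < n, z j = z' j) ∧ z n ≠ z' n := by
  classical
  have hex : ∃ n, z n ≠ z' n := Function.ne_iff.1 h
  exact ⟨Nat.find hex, fun j hj => not_not.1 (Nat.find_min hex hj), Nat.find_spec hex⟩

/-- A map from the Cantor space to `ℝ` that separates points at exponential rate has a range of
positive Hausdorff dimension. -/
theorem dimH_range_pos_of_separated {F : (ℕ → Bool) → ℝ} {ε ρ : ℝ} (hε : 0 < ε) (hρ : 0 < ρ)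
    (hρ1 : ρ < 1)
    (h : ∀ z z' n, (∀ j < n, z j = z' j) → z n ≠ z' n → ε * ρ ^ n ≤ |F z - F z'|) :
    0 < dimH (range F) := by
  have hinj : Function.Injective F := by
    intro z z' hzz
    by_contra hne
    obtain ⟨n, h1, h2⟩ := exists_first_ne hne
    have := h z z' n h1 h2
    rw [hzz, sub_self, abs_zero] at this
    have : 0 < ε * ρ ^ n := by positivity
    linarith
  let G : (ℕ → Bool) → ℝ := fun z => piQ 2 (fun j => (z j).toNat)
  let f := Function.extend F G 0
  have hfF : ∀ z, f (F z) = G z := fun z => hinj.extend_apply G 0 z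
  let r : ℝ := Real.logb ρ (1 / 2)
  have hr : 0 < r := Real.logb_pos_of_base_lt_one hρ hρ1 (by norm_num) (by norm_num)
  have hρr : ρ ^ r = 1 / 2 := Real.rpow_logb hρ hρ1.ne (by norm_num)
  let C : ℝ := (ε ^ r)⁻¹
  have hC : 0 ≤ C := by positivity
  have hbound : ∀ z z', |G z - G z'| ≤ C * |F z - F z'| ^ r := by
    intro z z'
    rcases eq_or_ne z z' with rfl | hne
    · simp [hr.ne']
    obtain ⟨n, h1, h2⟩ := exists_first_ne hne
    have hF := h z z' n h1 h2
    have hG := abs_piQ_sub_le_of_agree (M := 1) (q := 2) (n := n) (by norm_num)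
      (s := fun j => (z j).toNat) (t := fun j => (z' j).toNat) (fun _ => Bool.toNat_le _)
      (fun _ => Bool.toNat_le _) fun j hj => by rw [h1 j hj]
    calc |G z - G z'| ≤ ((2 : ℝ) ^ n)⁻¹ := by
          norm_num at hG
          exact hG
      _ = C * (ε * ρ ^ n) ^ r := by
          rw [Real.mul_rpow hε.le (by positivity), ← Real.rpow_natCast ρ n, ← Real.rpow_mul hρ.le,
            mul_comm (n : ℝ) r, Real.rpow_mul hρ.le, hρr, Real.rpow_natCast, ← mul_assoc,
            inv_mul_cancel₀ (by positivity), one_mul]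
          simp
      _ ≤ C * |F z - F z'| ^ r := by gcongr
  have hH : HolderOnWith C.toNNReal r.toNNReal f (range F) := by
    rintro _ ⟨z, rfl⟩ _ ⟨z', rfl⟩
    rw [hfF, hfF, edist_dist, edist_dist, Real.dist_eq, Real.dist_eq, Real.coe_toNNReal r hr.le,
      ENNReal.ofReal_rpow_of_nonneg (abs_nonneg _) hr.le, ENNReal.ofNNReal_toNNReal,
      ← ENNReal.ofReal_mul hC]
    exact ENNReal.ofReal_le_ofReal (hbound z z')
  have hdim := hH.dimH_image_le (Real.toNNReal_pos.2 hr)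
  have hsub : Icc (0 : ℝ) 1 ⊆ f '' range F := by
    intro x hx
    obtain ⟨z, hz⟩ := range_piQ_two_supset hx
    exact ⟨F z, ⟨z, rfl⟩, (hfF z).trans hz⟩
  have hone : dimH (Icc (0 : ℝ) 1) = 1 := by
    rw [Real.dimH_of_nonempty_interior (by simp)]
    simp
  have hle := (hone.symm.le.trans (dimH_mono hsub)).trans hdim
  rw [pos_iff_ne_zero]
  intro h0
  rw [h0, ENNReal.zero_div] at hle
  simp at hle

section Main

variable {M m : ℕ} {q u δ : ℝ} {a : ℕ → ℕ}

theorem IsUnivoqueSeq.piQ_blockSeq_le (ha : IsUnivoqueSeq M a) (hg : IsGoodLength M a m)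
    (hm : 2 ≤ m) (hq : 1 < q) (hδ : 0 < δ)
    (haδ : piQ q a + (q ^ m)⁻¹ * (M / (q - 1)) ≤ 1 - δ) (x : ℕ → Bool) (n : ℕ) :
    piQ q (fun k => blockSeq M a m x (n + k)) ≤ 1 - δ ∧
      piQ q (fun k => M - blockSeq M a m x (n + k)) ≤ 1 - δ := by
  constructor
  · refine piQ_le_of_lexLeUpto hq hδ ha.le_max haδ (fun _ => blockSeq_le ha.le_max _ _) fun l => ?_
    simp only [← add_assoc]
    exact (ha.lexLeUpto_blockSeq hg hm x (n + l)).1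
  · refine piQ_le_of_lexLeUpto hq hδ ha.le_max haδ (fun _ => Nat.sub_le _ _) fun l => ?_
    simp only [← add_assoc]
    exact (ha.lexLeUpto_blockSeq hg hm x (n + l)).2

theorem IsUnivoqueSeq.le_abs_piQ_blockSeq_sub (ha : IsUnivoqueSeq M a) (hg : IsGoodLength M a m)
    (hm : 2 ≤ m) (hq : 1 < q) (hδ : 0 < δ)
    (haδ : piQ q a + (q ^ m)⁻¹ * (M / (q - 1)) ≤ 1 - δ) {Q : ℝ} (hQ : q ≤ Q) {x y : ℕ → Bool}
    {n : ℕ} (h : ∀ j < n, x j = y j) (hn : x n ≠ y n) :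
    (Q ^ (m * n + m))⁻¹ * δ ≤ |piQ Q (blockSeq M a m x) - piQ Q (blockSeq M a m y)| := by
  have hQ1 : 1 < Q := by linarith
  have hQ0 : 0 < Q := by linarith
  have hle : ∀ z : ℕ → Bool, ∀ i, blockSeq M a m z i ≤ M := blockSeq_le ha.le_max
  have hne := blockSeq_ne (ha.le_max _) (ha.last_pos hg hm).1 (by omega) h hn
  have htail : ∀ z : ℕ → Bool, ∀ l, piQ Q (fun k => blockSeq M a m z (l + k)) ≤ 1 - δ :=
    fun z l => (piQ_anti hq hQ fun _ => hle _ _).trans (ha.piQ_blockSeq_le hg hm hq hδ haδ z l).1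
  have hpi := piQ_sub_of_first_diff hQ1 (hle x) (hle y) (k := m * n + (m - 1))
    fun i hi => blockSeq_congr h hi
  rw [hpi, show m * n + (m - 1) + 1 = m * n + m by omega, abs_mul,
    abs_of_pos (by positivity : 0 < (Q ^ (m * n + m))⁻¹)]
  gcongr
  have t1 := htail x (m * n + m)
  have t2 := htail y (m * n + m)
  have t3 := piQ_nonneg hQ1 fun k => blockSeq M a m x (m * n + m + k)
  have t4 := piQ_nonneg hQ1 fun k => blockSeq M a m y (m * n + m + k)
  rw [le_abs]
  rcases lt_or_gt_of_ne hne with hlt | hlt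
  · right
    have : (blockSeq M a m x (m * n + (m - 1)) : ℝ) + 1 ≤ blockSeq M a m y (m * n + (m - 1)) := by
      exact_mod_cast hlt
    linarith
  · left
    have : (blockSeq M a m y (m * n + (m - 1)) : ℝ) + 1 ≤ blockSeq M a m x (m * n + (m - 1)) := by
      exact_mod_cast hlt
    linarith

theorem IsUnivoqueSeq.blockSeq_notMem_UnivSeqs (ha : IsUnivoqueSeq M a)
    (hg : IsGoodLength M a m) (hm : 2 ≤ m) {p : ℝ} (hp : 1 < p) (hpM : p ≤ M + 1)
    (hap : 1 ≤ piQ p a - (p ^ m)⁻¹ * (M / (p - 1))) {x : ℕ → Bool} (hx : ∀ j < 3, x j = true) :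
    blockSeq M a m x ∉ UnivSeqs M p := by
  intro hmem
  have hlast := (ha.last_pos hg hm).1
  have hle := ha.le_max (m - 1)
  have hs1 : blockSign x 1 = true := by simp [blockSign, hx 0]
  have hs2 : blockSign x 2 = false := by
    rw [blockSign, hs1, hx 1 (by omega)]
    rfl
  have h1 : blockSeq M a m x (m * 1 + (m - 1)) < M := by
    rw [blockSeq_mul_add x 1 (by omega), hs1, hx 1 (by omega)]
    simp only [if_true, lowerLast, Bool.true_eq_false, false_and, if_false]
    omega
  have h2 := UnivSeqs.tail_lt_one hp hpM hmem h1
  have h3 := abs_piQ_sub_le_of_agree hp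
    (s := fun k => blockSeq M a m x (m * 1 + (m - 1) + 1 + k)) (n := m)
    (fun _ => blockSeq_le ha.le_max _ _) ha.le_max fun i hi => by
      rw [show m * 1 + (m - 1) + 1 + i = m * 2 + i by omega, blockSeq_mul_add x 2 hi, hs2,
        hx 2 (by omega)]
      simp [lowerLast]
  have := (abs_le.1 h3).1
  linarith

theorem dimH_pos_of_univBases_between {p : ℝ} (hM : 0 < M) (hq : q ≤ M + 1) (hp : 1 < p)
    (hu : u ∈ UnivBases M) (hpu : p < u) (huq : u < q) :
    0 < dimH (piQ ((M : ℝ) + 1) '' (UnivSeqs M q \ UnivSeqs M p)) := by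
  obtain ⟨hu1, huM, d, ⟨hd, hd1⟩, huniq⟩ := hu
  have hq1 : 1 < q := by linarith
  have hdU : d ∈ UnivSeqs M u := ⟨hd, fun e he => huniq e (by rwa [hd1] at he)⟩
  have ha := isUnivoqueSeq_of_mem hu1 huM hM hdU hd1
  have hqa : piQ q d < 1 := hd1 ▸ piQ_strictAnti hu1 huq hd ha.zero_ne
  have hpa : 1 < piQ p d := hd1 ▸ piQ_strictAnti hp hpu hd ha.zero_ne
  have hlim : ∀ {r : ℝ}, 1 < r →
      Tendsto (fun n : ℕ => (r ^ n)⁻¹ * (M / (r - 1))) atTop (nhds 0) := fun {r} hr => by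
    have := (tendsto_pow_atTop_nhds_zero_of_lt_one (r := r⁻¹) (by positivity)
      (inv_lt_one_of_one_lt₀ hr)).mul_const ((M : ℝ) / (r - 1))
    simpa only [zero_mul, inv_pow] using this
  obtain ⟨N, hN⟩ := eventually_atTop.1 <|
    ((hlim hq1).eventually (gt_mem_nhds (half_pos (sub_pos.2 hqa)))).and <|
      ((hlim hp).eventually (gt_mem_nhds (sub_pos.2 hpa))).and (eventually_ge_atTop 2)
  obtain ⟨m, hmN, hg⟩ := ha.exists_isGoodLength N
  obtain ⟨hm1, hm2, hm⟩ := hN m hmN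
  obtain ⟨δ, hδ, haδ⟩ : ∃ δ > 0, piQ q d + (q ^ m)⁻¹ * (M / (q - 1)) ≤ 1 - δ :=
    ⟨(1 - piQ q d) / 2, by linarith, by linarith⟩
  let pad : (ℕ → Bool) → ℕ → Bool := fun z j => if j < 3 then true else z (j - 3)
  have hM1 : (1 : ℝ) < M + 1 := by linarith
  have hpos : 0 < dimH (range fun z => piQ ((M : ℝ) + 1) (blockSeq M d m (pad z))) := by
    refine dimH_range_pos_of_separated (ε := (((M : ℝ) + 1) ^ (4 * m))⁻¹ * δ)
      (ρ := (((M : ℝ) + 1) ^ m)⁻¹) (by positivity) (by positivity)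
      (inv_lt_one_of_one_lt₀ (one_lt_pow₀ hM1 (by omega))) fun z z' n h hn => ?_
    have := ha.le_abs_piQ_blockSeq_sub hg hm hq1 hδ haδ hq (x := pad z) (y := pad z') (n := n + 3)
      (fun j hj => by
        simp only [pad]
        split_ifs
        · rfl
        · exact h _ (by omega))
      (by simpa [pad] using hn)
    convert this using 1
    rw [inv_pow, ← pow_mul, mul_right_comm, ← mul_inv, ← pow_add]
    congr 3
    ring
  refine hpos.trans_le (dimH_mono ?_)
  rintro _ ⟨z, rfl⟩
  refine ⟨_, ⟨?_, ?_⟩, rfl⟩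
  · refine mem_UnivSeqs_of_tail_lt_one hq1 (blockSeq_le ha.le_max _) (fun n => ?_) fun n => ?_
    · linarith [(ha.piQ_blockSeq_le hg hm hq1 hδ haδ (pad z) n).1]
    · linarith [(ha.piQ_blockSeq_le hg hm hq1 hδ haδ (pad z) n).2]
  · exact ha.blockSeq_notMem_UnivSeqs hg hm hp (by linarith) (by linarith)
      fun j hj => by simp [pad, hj]

theorem exists_univBases_between (hq : q ≤ M + 1) (hqc : q ∈ closure (UnivBases M))
    (hne : q ≠ KL M) (hstar : ¬∃ b : ℝ, CC M b q) {p : ℝ} (hp : p < q) :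
    ∃ u ∈ UnivBases M, p < u ∧ u < q := by
  by_contra! hno
  apply hstar
  have hbdd : BddBelow (UnivBases M) := ⟨1, fun x hx => hx.1.le⟩
  have hKL : ∀ x ∈ closure (UnivBases M), KL M ≤ x := fun x hx =>
    closure_minimal (fun y hy => csInf_le hbdd hy) isClosed_Ici hx
  have hKLq : KL M < q := lt_of_le_of_ne (hKL q hqc) hne.symm
  have hU : (UnivBases M).Nonempty := closure_nonempty_iff.1 ⟨q, hqc⟩
  obtain ⟨v, hv, hvq⟩ := exists_lt_of_csInf_lt hU hKLq
  have hgap : closure (UnivBases M) ∩ Iio q ⊆ Iic p := by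
    rintro x ⟨hx, hxq⟩
    by_contra hxp
    obtain ⟨u, hu, huU⟩ := mem_closure_iff.1 hx (Ioo p q) isOpen_Ioo ⟨not_le.1 hxp, hxq⟩
    exact (hno u huU hu.1).not_gt hu.2
  have heq : closure (UnivBases M) ∩ Iio q = closure (UnivBases M) ∩ Iic p :=
    Subset.antisymm (fun x hx => ⟨hx.1, hgap hx⟩) fun x hx => ⟨hx.1, lt_of_le_of_lt hx.2 hp⟩
  have hb : BddAbove (closure (UnivBases M) ∩ Iio q) := ⟨q, fun x hx => hx.2.le⟩
  have hmem : sSup (closure (UnivBases M) ∩ Iio q) ∈ closure (UnivBases M) ∩ Iio q := by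
    refine IsClosed.csSup_mem ?_ ⟨v, subset_closure hv, hvq⟩ hb
    rw [heq]
    exact isClosed_closure.inter isClosed_Iic
  refine ⟨sSup (closure (UnivBases M) ∩ Iio q), hmem.2, fun x hx => ⟨⟨?_, ?_⟩, fun hxc => ?_⟩,
    fun h => h.2 hmem.1, fun h => h.2 hqc⟩
  · exact (hKL _ hmem.1).trans_lt hx.1
  · exact hx.2.trans_le hq
  · exact (le_csSup hb ⟨hxc, hx.2⟩).not_gt hx.1

end Main

/-- If `q ∈ closure U`, `q ≠ q'` and `q` is not the right endpoint of any
connected component of `(q', M+1) \ closure U`, then for every `p ∈ (1, q)`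
the Hausdorff dimension of `π_{M+1}(U'_q \ U'_p)` is strictly positive. -/
theorem stmt4 (M : ℕ) (hM : 0 < M) (q : ℝ) (hq : q ∈ Ioc 1 ((M : ℝ) + 1))
    (hqc : q ∈ closure (UnivBases M)) (hne : q ≠ KL M)
    (hstar : ¬∃ a : ℝ, CC M a q) :
    ∀ p ∈ Ioo (1 : ℝ) q,
      0 < dimH (piQ ((M : ℝ) + 1) '' (UnivSeqs M q \ UnivSeqs M p)) := by
  intro p hp
  obtain ⟨u, hu, hpu, huq⟩ := exists_univBases_between hq.2 hqc hne hstar hp.2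
  exact dimH_pos_of_univBases_between hM hq.2 hp.1 hu hpu huq

end
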